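/- Let t₀ > 0, let (t_m)_{m∈ℕ} be real numbers with t_m ≥ t₀ for all m, let (a_m)_{m∈ℕ} be complex numbers, let λ₀ ∈ ℝ and λ ∈ ℂ with λ₀ < Re λ, and assume Σ_{m} |a_m| e^{−λ₀ t_m} < ∞. Then for every s ∈ ℂ the series G(s) := Σ_{m} a_m · t_m^{s−1} · e^{−λ t_m} converges absolutely, G is differentiable at s = 0, and the function s ↦ G(s) · (Γ(s))⁻¹ is differentiable at 0 with derivative equal to G(0) = Σ_{m} a_m · t_m^{−1} · e^{−λ t_m}. -/

import Mathlib

/-- On `[x₀, ∞)` the absolute value of the logarithm is bounded by an affine function of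
arbitrarily small positive slope. -/
theorem abs_log_le_mul_add {x₀ k x : ℝ} (hx₀ : 0 < x₀) (hk : 0 < k) (hx : x₀ ≤ x) :
    |Real.log x| ≤ k * x + (|Real.log k| + |Real.log x₀|) := by
  have hx_pos : 0 < x := hx₀.trans_le hx
  have hupper := Real.log_le_sub_one_of_pos (mul_pos hk hx_pos)
  rw [Real.log_mul hk.ne' hx_pos.ne'] at hupper
  have hlower := Real.log_le_log hx₀ hx
  have hkx := mul_pos hk hx_pos
  rw [abs_le]
  constructor <;> linarith [neg_abs_le (Real.log k), neg_abs_le (Real.log x₀),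
    abs_nonneg (Real.log k), abs_nonneg (Real.log x₀)]

theorem norm_ofReal_cpow_le_exp {x : ℝ} (hx : 0 < x) (z : ℂ) :
    ‖(x : ℂ) ^ z‖ ≤ Real.exp (‖z‖ * |Real.log x|) := by
  rw [Complex.norm_cpow_eq_rpow_re_of_pos hx, Real.rpow_def_of_pos hx, Real.exp_le_exp]
  calc Real.log x * z.re ≤ |Real.log x * z.re| := le_abs_self _
    _ = |z.re| * |Real.log x| := by rw [abs_mul, mul_comm]
    _ ≤ ‖z‖ * |Real.log x| := by gcongr; exact Complex.abs_re_le_norm z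

/-- On a ball of exponents, powers of `x ≥ x₀ > 0` are absorbed by an arbitrarily small loss in
the exponential decay rate, uniformly in `x`. -/
theorem exists_norm_cpow_mul_exp_le {x₀ lam₀ R : ℝ} {lam : ℂ} (hx₀ : 0 < x₀)
    (hlam : lam₀ < lam.re) (hR : 0 < R) :
    ∃ C : ℝ, ∀ x : ℝ, x₀ ≤ x → ∀ z : ℂ, ‖z‖ ≤ R →
      ‖(x : ℂ) ^ z * Complex.exp (-lam * (x : ℂ))‖ ≤ C * Real.exp (-lam₀ * x) := by
  set k := (lam.re - lam₀) / R with hk_def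
  have hk : 0 < k := div_pos (sub_pos.mpr hlam) hR
  have hRk : R * k = lam.re - lam₀ := by rw [hk_def]; field_simp
  refine ⟨Real.exp (R * (|Real.log k| + |Real.log x₀|)), fun x hx z hz => ?_⟩
  have hexp : ‖Complex.exp (-lam * (x : ℂ))‖ = Real.exp (-lam.re * x) := by
    simp [Complex.norm_exp]
  rw [norm_mul, hexp]
  calc ‖(x : ℂ) ^ z‖ * Real.exp (-lam.re * x)
      ≤ Real.exp (R * (k * x + (|Real.log k| + |Real.log x₀|))) * Real.exp (-lam.re * x) := by
        gcongr
        refine (norm_ofReal_cpow_le_exp (hx₀.trans_le hx) z).trans (Real.exp_le_exp.mpr ?_)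
        exact mul_le_mul hz (abs_log_le_mul_add hx₀ hk hx) (abs_nonneg _) hR.le
    _ = Real.exp (R * (|Real.log k| + |Real.log x₀|)) * Real.exp (-lam₀ * x) := by
        rw [← Real.exp_add, ← Real.exp_add]
        congr 1
        linear_combination x * hRk

theorem hasDerivAt_inv_Gamma_zero :
    HasDerivAt (fun s : ℂ => (Complex.Gamma s)⁻¹) 1 0 := by
  rw [funext Complex.one_div_Gamma_eq_self_mul_one_div_Gamma_add_one]
  have hdiff : DifferentiableAt ℂ (fun s : ℂ => (Complex.Gamma (s + 1))⁻¹) 0 :=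
    (Complex.differentiable_one_div_Gamma.comp (differentiable_id.add_const 1)) 0
  simpa using (hasDerivAt_id (0 : ℂ)).fun_mul hdiff.hasDerivAt

/-- Let `t₀ > 0`, let `(t_m)` be reals with `t_m ≥ t₀`, `(a_m)` complex,
`λ₀ < Re λ`, and suppose `∑ |a_m| e^{-λ₀ t_m} < ∞`.  Then for every `s ∈ ℂ` the series
`G(s) := ∑ a_m t_m^{s-1} e^{-λ t_m}` converges absolutely, `G` is differentiable at `0`, and
`s ↦ G(s)·(Γ(s))⁻¹` is differentiable at `0` with derivative
`G(0) = ∑ a_m t_m⁻¹ e^{-λ t_m}`. -/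
theorem mellin_dirichlet_series_inv_gamma_hasDerivAt
    (t₀ : ℝ) (ht₀ : 0 < t₀) (t : ℕ → ℝ) (ht : ∀ m, t₀ ≤ t m) (a : ℕ → ℂ)
    (lam₀ : ℝ) (lam : ℂ) (hlam : lam₀ < lam.re)
    (hsum : Summable fun m => ‖a m‖ * Real.exp (-lam₀ * t m)) :
    (∀ s : ℂ, Summable fun m =>
        ‖a m * (t m : ℂ) ^ (s - 1) * Complex.exp (-lam * (t m : ℂ))‖) ∧
      DifferentiableAt ℂ
        (fun s : ℂ => ∑' m, a m * (t m : ℂ) ^ (s - 1) * Complex.exp (-lam * (t m : ℂ))) 0 ∧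
      ((∑' m, a m * (t m : ℂ) ^ ((0 : ℂ) - 1) * Complex.exp (-lam * (t m : ℂ))) =
        ∑' m, a m * (t m : ℂ)⁻¹ * Complex.exp (-lam * (t m : ℂ))) ∧
      HasDerivAt
        (fun s : ℂ =>
          (∑' m, a m * (t m : ℂ) ^ (s - 1) * Complex.exp (-lam * (t m : ℂ))) *
            (Complex.Gamma s)⁻¹)
        (∑' m, a m * (t m : ℂ)⁻¹ * Complex.exp (-lam * (t m : ℂ))) 0 := by
  have hbound : ∀ R : ℝ, 0 < R → ∃ C : ℝ, ∀ m, ∀ s : ℂ, ‖s - 1‖ ≤ R →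
      ‖a m * (t m : ℂ) ^ (s - 1) * Complex.exp (-lam * (t m : ℂ))‖ ≤
        C * (‖a m‖ * Real.exp (-lam₀ * t m)) := by
    intro R hR
    obtain ⟨C, hC⟩ := exists_norm_cpow_mul_exp_le ht₀ hlam hR
    refine ⟨C, fun m s hs => ?_⟩
    rw [mul_assoc, norm_mul, mul_left_comm]
    exact mul_le_mul_of_nonneg_left (hC (t m) (ht m) (s - 1) hs) (norm_nonneg _)
  have hdiff : DifferentiableAt ℂ
      (fun s : ℂ => ∑' m, a m * (t m : ℂ) ^ (s - 1) * Complex.exp (-lam * (t m : ℂ))) 0 := by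
    obtain ⟨C, hC⟩ := hbound 2 two_pos
    refine (Complex.differentiableOn_tsum_of_summable_norm (hsum.mul_left C) (fun m => ?_)
      (Metric.isOpen_ball (x := (1 : ℂ)) (ε := 2))
      (fun m s hs => hC m s (mem_ball_iff_norm.mp hs).le)).differentiableAt
      (Metric.isOpen_ball.mem_nhds (by simp))
    have ht_ne : (t m : ℂ) ≠ 0 := Complex.ofReal_ne_zero.mpr (ht₀.trans_le (ht m)).ne'
    exact ((((differentiable_id.sub_const (1 : ℂ)).const_cpow (Or.inl ht_ne)).const_mul
      (a m)).mul_const _).differentiableOn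
  have hzero : (∑' m, a m * (t m : ℂ) ^ ((0 : ℂ) - 1) * Complex.exp (-lam * (t m : ℂ))) =
      ∑' m, a m * (t m : ℂ)⁻¹ * Complex.exp (-lam * (t m : ℂ)) := by
    simp only [zero_sub, Complex.cpow_neg_one]
  refine ⟨fun s => ?_, hdiff, hzero, ?_⟩
  · obtain ⟨C, hC⟩ := hbound (‖s - 1‖ + 1) (by positivity)
    exact (hsum.mul_left C).of_nonneg_of_le (fun _ => norm_nonneg _)
      fun m => hC m s (le_add_of_nonneg_right zero_le_one)
  · rw [← hzero]
    simpa [Complex.Gamma_zero] using hdiff.hasDerivAt.fun_mul hasDerivAt_inv_Gamma_zero
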